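/- Let X be a non-empty set. Every infinite subset A of the free Boolean group B(X) can be split by some map f : X → Z₂; that is, there exists f : X → Z₂ such that for each i ∈ {0,1} the set {a ∈ A : f̃(a) = i} is infinite. -/

import Mathlib

/-- The unique extension of `f : X → ZMod 2` to a homomorphism on the free Boolean group
`B(X)` of finite subsets of `X` (with symmetric difference as addition):
`f̃(a) = ∑ x ∈ a, f x`. -/
def extHom {X : Type*} (f : X → ZMod 2) (a : Finset X) : ZMod 2 :=
  ∑ x ∈ a, f x

/-- A map `f : X → ZMod 2` splits a subset `A` of the free Boolean group `B(X)` provided that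
`{a ∈ A : f̃(a) = i}` is infinite for each `i = 0, 1`. -/
def Splits {X : Type*} (f : X → ZMod 2) (A : Set (Finset X)) : Prop :=
  ∀ i : ZMod 2, {a ∈ A | extHom f a = i}.Infinite

/-- The identification of `B(X)` with the free `ZMod 2`-module on `X`. -/
noncomputable def toFinsupp {X : Type*} (a : Finset X) : X →₀ ZMod 2 :=
  ∑ x ∈ a, Finsupp.single x 1

theorem toFinsupp_injective {X : Type*} :
    Function.Injective (toFinsupp : Finset X → X →₀ ZMod 2) := by
  classical
  have key (a : Finset X) (x : X) : toFinsupp a x = if x ∈ a then 1 else 0 := by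
    simp [toFinsupp, Finsupp.finsetSum_apply, Finsupp.single_apply]
  intro a b h
  ext x
  have hx := DFunLike.congr_fun h x
  rw [key, key] at hx
  by_cases ha : x ∈ a <;> by_cases hb : x ∈ b <;> simp_all

theorem extHom_eq_map_toFinsupp {X : Type*} (g : (X →₀ ZMod 2) →ₗ[ZMod 2] ZMod 2)
    (a : Finset X) : extHom (fun x => g (Finsupp.single x 1)) a = g (toFinsupp a) := by
  simp [extHom, toFinsupp, map_sum]

theorem Set.Infinite.exists_infinite_linearIndepOn {K V : Type*} [Field K] [Finite K]
    [AddCommGroup V] [Module K V] {t : Set V} (ht : t.Infinite) :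
    ∃ b ⊆ t, b.Infinite ∧ LinearIndepOn K id b := by
  obtain ⟨b, hbt, hspan, hli⟩ := exists_linearIndependent K t
  refine ⟨b, hbt, fun hb => ht ?_, hli⟩
  have : Module.Finite K (Submodule.span K b) := Module.Finite.span_of_finite K hb
  have : Finite (Submodule.span K b) := Module.finite_of_finite K
  have hfin : (Submodule.span K b : Set V).Finite := Set.toFinite _
  exact hfin.subset (hspan ▸ Submodule.subset_span)

theorem Set.Infinite.exists_infinite_fibers {V : Type*} {b : Set V} (hb : b.Infinite) :
    ∃ c : V → ZMod 2, ∀ i, {v ∈ b | c v = i}.Infinite := by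
  obtain ⟨_⟩ := nonempty_denumerable (ℕ × ZMod 2)
  obtain ⟨e⟩ : Nonempty (ℕ × ZMod 2 ↪ b) :=
    ⟨(Denumerable.eqv (ℕ × ZMod 2)).toEmbedding.trans (hb.natEmbedding b)⟩
  have he : Function.Injective fun p => (e p : V) := Subtype.val_injective.comp e.injective
  refine ⟨Function.extend (fun p => (e p : V)) Prod.snd 0, fun i => ?_⟩
  refine Set.infinite_of_injective_forall_mem (f := fun n : ℕ => (e (n, i) : V)) ?_ fun n => ?_
  · intro m n h
    simpa using he h
  · exact ⟨(e (n, i)).2, he.extend_apply Prod.snd 0 (n, i)⟩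

theorem LinearIndepOn.exists_linearMap_eqOn {K V W : Type*} [Field K] [AddCommGroup V]
    [Module K V] [AddCommGroup W] [Module K W] {b : Set V} (hb : LinearIndepOn K id b)
    (c : V → W) : ∃ g : V →ₗ[K] W, Set.EqOn g c b := by
  refine ⟨(Module.Basis.extend hb).constr K fun v => c v, fun v hv => ?_⟩
  simpa using (Module.Basis.extend hb).constr_basis K (fun v => c v)
    ⟨v, hb.subset_extend _ hv⟩

theorem infinite_subset_of_free_boolean_group_can_be_split
    (X : Type*) [Nonempty X] (A : Set (Finset X)) (hA : A.Infinite) :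
    ∃ f : X → ZMod 2, Splits f A := by
  obtain ⟨b, hbA, hb, hli⟩ :=
    (hA.image toFinsupp_injective.injOn).exists_infinite_linearIndepOn (K := ZMod 2)
  obtain ⟨c, hc⟩ := hb.exists_infinite_fibers
  obtain ⟨g, hg⟩ := hli.exists_linearMap_eqOn c
  refine ⟨fun x => g (Finsupp.single x 1), fun i => Set.Infinite.of_image toFinsupp ?_⟩
  refine (hc i).mono ?_
  rintro v ⟨hv, rfl⟩
  obtain ⟨a, ha, rfl⟩ := hbA hv
  exact ⟨a, ⟨ha, (extHom_eq_map_toFinsupp g a).trans (hg hv)⟩, rfl⟩
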